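/- arXiv:0801.4798 — 3 statements merged into one kernel-verified Lean document; each statement's English description precedes it below -/
import Mathlib

section
/- Let N ≥ 1 be an integer and let ρ(y) = exp(|y|²/4) for y ∈ ℝ^N. Let f : ℝ^N → ℝ be continuously differentiable with ∫_{ℝ^N} f(y)² ρ(y) dy < ∞ and ∫_{ℝ^N} |∇f(y)|² ρ(y) dy < ∞. Then (N/2)·∫_{ℝ^N} f(y)² ρ(y) dy ≤ ∫_{ℝ^N} |∇f(y)|² ρ(y) dy. -/
open MeasureTheory Real
open scoped InnerProductSpace

noncomputable def rho {N : ℕ} (y : EuclideanSpace ℝ (Fin N)) : ℝ := Real.exp (‖y‖ ^ 2 / 4)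

/-- The Laplacian of `f : ℝ^N → ℝ`: `Δf = ∑ i, ∂²f/∂yᵢ²`. -/
noncomputable def lap {N : ℕ} (f : EuclideanSpace ℝ (Fin N) → ℝ)
    (x : EuclideanSpace ℝ (Fin N)) : ℝ :=
  ∑ i : Fin N, fderiv ℝ (fun z => fderiv ℝ f z (EuclideanSpace.single i 1)) x
    (EuclideanSpace.single i 1)

/-- For a compactly supported `C¹` function `H`, `N ∫ H = -∫ y · ∇H`. -/
theorem dimension_mul_integral_eq_neg_integral_fderiv_self {N : ℕ}
    {H : EuclideanSpace ℝ (Fin N) → ℝ} (hH : ContDiff ℝ 1 H) (hc : HasCompactSupport H) :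
    (N : ℝ) * ∫ y, H y = -∫ y, fderiv ℝ H y y := by
  have hd : Continuous (fderiv ℝ H) := hH.continuous_fderiv one_ne_zero
  have hcd : HasCompactSupport (fderiv ℝ H) := hc.fderiv ℝ
  have hint (i : Fin N) :
      Integrable fun y => fderiv ℝ H y (EuclideanSpace.single i 1) * y i := by
    apply Continuous.integrable_of_hasCompactSupport
    · fun_prop
    · exact hcd.mono fun y hy h => hy (by simp [h])
  have hcoord (i : Fin N) (y : EuclideanSpace ℝ (Fin N)) :
      HasFDerivAt (fun z : EuclideanSpace ℝ (Fin N) => z i)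
        (EuclideanSpace.proj i : EuclideanSpace ℝ (Fin N) →L[ℝ] ℝ) y :=
    (EuclideanSpace.proj i : EuclideanSpace ℝ (Fin N) →L[ℝ] ℝ).hasFDerivAt
  have hparts (i : Fin N) :
      ∫ y, H y = -∫ y, fderiv ℝ H y (EuclideanSpace.single i 1) * y i := by
    have h := integral_bilinear_hasFDerivAt_right_eq_neg_left_of_integrable
      (μ := (volume : Measure (EuclideanSpace ℝ (Fin N))))
      (B := ContinuousLinearMap.mul ℝ ℝ) (v := EuclideanSpace.single i 1) (f := H)
      (f' := fderiv ℝ H) (g := fun z => z i) (g' := fun _ => EuclideanSpace.proj i)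
      (by simpa using hint i)
      (by simpa using hH.continuous.integrable_of_hasCompactSupport hc)
      (by
        apply Continuous.integrable_of_hasCompactSupport
        · have := hH.continuous
          simp only [ContinuousLinearMap.mul_apply']
          fun_prop
        · exact hc.mono fun y hy h => hy (by simp [h]))
      (fun y _ => (hH.differentiable one_ne_zero y).hasFDerivAt)
      (fun y _ => hcoord i y)
    simpa using h
  have hsum (y : EuclideanSpace ℝ (Fin N)) :
      fderiv ℝ H y y = ∑ i, fderiv ℝ H y (EuclideanSpace.single i 1) * y i := by
    have h := congrArg (fderiv ℝ H y) ((EuclideanSpace.basisFun (Fin N) ℝ).sum_repr y).symm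
    simpa [mul_comm] using h
  simp_rw [hsum]
  rw [integral_finsetSum _ fun i _ => hint i, ← Finset.sum_neg_distrib,
    ← Finset.sum_congr rfl fun i _ => hparts i]
  simp

/-- Dilating a bounded continuous multiplier to its value at the origin passes to the limit under
the integral. -/
theorem tendsto_integral_dilation_mul {N : ℕ} {ψ g : EuclideanSpace ℝ (Fin N) → ℝ} {C : ℝ}
    (hψ : Continuous ψ) (hC : ∀ y, ‖ψ y‖ ≤ C) (hg : Integrable g) :
    Filter.Tendsto (fun n : ℕ => ∫ y, ψ ((1 / ((n : ℝ) + 1)) • y) * g y) Filter.atTop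
      (nhds (ψ 0 * ∫ y, g y)) := by
  rw [← integral_const_mul]
  apply tendsto_integral_of_dominated_convergence (fun y => C * ‖g y‖)
  · intro n
    exact (hψ.comp (continuous_const_smul _)).aestronglyMeasurable.mul hg.aestronglyMeasurable
  · exact hg.norm.const_mul C
  · intro n
    filter_upwards with y
    rw [norm_mul]
    exact mul_le_mul_of_nonneg_right (hC _) (norm_nonneg _)
  · filter_upwards with y
    apply Filter.Tendsto.mul_const
    have h : Filter.Tendsto (fun n : ℕ => (1 / ((n : ℝ) + 1)) • y) Filter.atTop (nhds 0) := by
      simpa using (tendsto_one_div_add_atTop_nhds_zero_nat (𝕜 := ℝ)).smul_const y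
    exact (hψ.tendsto 0).comp h

theorem hasFDerivAt_rho {N : ℕ} (y : EuclideanSpace ℝ (Fin N)) :
    HasFDerivAt rho ((rho y / 2) • innerSL ℝ y) y := by
  have h := ((hasStrictFDerivAt_norm_sq y).hasFDerivAt.mul_const (4⁻¹ : ℝ)).exp
  convert! h using 1
  ext v
  simp [rho, div_eq_mul_inv]
  ring

theorem contDiff_rho {N : ℕ} : ContDiff ℝ 1 (rho : EuclideanSpace ℝ (Fin N) → ℝ) :=
  ((contDiff_norm_sq ℝ).div_const 4).exp

/-- The spectral inequality localized by a compactly supported cutoff `φ`. -/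
theorem spectral_inequality_cutoff {N : ℕ} {f φ : EuclideanSpace ℝ (Fin N) → ℝ}
    (hf : ContDiff ℝ 1 f) (hφ : ContDiff ℝ 1 φ) (hc : HasCompactSupport φ)
    (hφ0 : ∀ y, 0 ≤ φ y) :
    ((N : ℝ) / 2) * ∫ y, φ y * (f y ^ 2 * rho y) ≤
      (∫ y, φ y * (‖gradient f y‖ ^ 2 * rho y)) -
        (1 / 2) * ∫ y, fderiv ℝ φ y y * (f y ^ 2 * rho y) := by
  have hρ := contDiff_rho (N := N)
  have hfc := hf.continuous
  have hφc := hφ.continuous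
  have hρc := hρ.continuous
  have hdf : Continuous (fderiv ℝ f) := hf.continuous_fderiv one_ne_zero
  have hdφ : Continuous (fderiv ℝ φ) := hφ.continuous_fderiv one_ne_zero
  have hgrad : Continuous (gradient f) :=
    (InnerProductSpace.toDual ℝ _).symm.continuous.comp hdf
  have hcd : HasCompactSupport (fderiv ℝ φ) := hc.fderiv ℝ
  have key := dimension_mul_integral_eq_neg_integral_fderiv_self
    (H := fun y => φ y * (f y ^ 2 * rho y)) (hφ.mul ((hf.pow 2).mul hρ)) hc.mul_right
  have hderiv (y : EuclideanSpace ℝ (Fin N)) :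
      fderiv ℝ (fun z => φ z * (f z ^ 2 * rho z)) y y =
        fderiv ℝ φ y y * (f y ^ 2 * rho y) +
          φ y * ((2 * (f y * fderiv ℝ f y y) + f y ^ 2 * ‖y‖ ^ 2 / 2) * rho y) := by
    have h := (hφ.differentiable one_ne_zero y).hasFDerivAt.mul
      (((hf.differentiable one_ne_zero y).hasFDerivAt.pow 2).mul (hasFDerivAt_rho y))
    have h' := congrArg (fun L => L y) h.fderiv
    simp [Pi.mul_def] at h'
    simp [h']
    ring
  have hI1 : Integrable fun y => fderiv ℝ φ y y * (f y ^ 2 * rho y) := by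
    apply Continuous.integrable_of_hasCompactSupport
    · fun_prop
    · exact hcd.mono fun y hy h => hy (by simp [h])
  have hI2 : Integrable fun y =>
      φ y * ((2 * (f y * fderiv ℝ f y y) + f y ^ 2 * ‖y‖ ^ 2 / 2) * rho y) := by
    apply Continuous.integrable_of_hasCompactSupport
    · fun_prop
    · exact hc.mul_right
  have hI3 : Integrable fun y => φ y * (‖gradient f y‖ ^ 2 * rho y) := by
    apply Continuous.integrable_of_hasCompactSupport
    · fun_prop
    · exact hc.mul_right
  simp_rw [hderiv] at key
  rw [integral_add hI1 hI2] at key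
  have hpos : 0 ≤ ∫ y, (φ y * (‖gradient f y‖ ^ 2 * rho y) + (1 / 2) *
      (φ y * ((2 * (f y * fderiv ℝ f y y) + f y ^ 2 * ‖y‖ ^ 2 / 2) * rho y))) := by
    apply integral_nonneg
    intro y
    have hinner : fderiv ℝ f y y = ⟪gradient f y, y⟫_ℝ := by
      simp [gradient]
    have hsq : ‖gradient f y + (f y / 2) • y‖ ^ 2 =
        ‖gradient f y‖ ^ 2 + f y * fderiv ℝ f y y + f y ^ 2 * ‖y‖ ^ 2 / 4 := by
      rw [norm_add_sq_real, inner_smul_right, norm_smul, mul_pow, hinner, norm_eq_abs, sq_abs]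
      ring
    have h : 0 ≤ φ y * (‖gradient f y + (f y / 2) • y‖ ^ 2 * rho y) :=
      mul_nonneg (hφ0 y) (mul_nonneg (sq_nonneg _) (exp_pos _).le)
    rw [hsq] at h
    simp only [Pi.zero_apply]
    linarith
  rw [integral_add hI3 (hI2.const_mul _), integral_const_mul] at hpos
  linarith

/-- the spectral inequality `(N/2)·∫ f² ρ ≤ ∫ |∇f|² ρ`
with weight `ρ(y) = exp(|y|²/4)`, for `f` C¹ with both integrals finite. -/
theorem stmt2 (N : ℕ) (hN : 1 ≤ N) (f : EuclideanSpace ℝ (Fin N) → ℝ)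
    (hf : ContDiff ℝ 1 f)
    (h1 : Integrable (fun y => f y ^ 2 * rho y))
    (h2 : Integrable (fun y => ‖gradient f y‖ ^ 2 * rho y)) :
    ((N : ℝ) / 2) * ∫ y, f y ^ 2 * rho y ≤ ∫ y, ‖gradient f y‖ ^ 2 * rho y := by
  let b : ContDiffBump (0 : EuclideanSpace ℝ (Fin N)) := ⟨1, 2, one_pos, one_lt_two⟩
  have hb : ContDiff ℝ 1 b := b.contDiff
  have hbd : Continuous fun z => fderiv ℝ b z z :=
    (hb.continuous_fderiv one_ne_zero).clm_apply continuous_id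
  have hbds : HasCompactSupport fun z => fderiv ℝ b z z :=
    (b.hasCompactSupport.fderiv ℝ).mono fun z hz h => hz (by simp [h])
  obtain ⟨C, hC⟩ := hbds.exists_bound_of_continuous hbd
  have hb1 (z : EuclideanSpace ℝ (Fin N)) : ‖b z‖ ≤ 1 := by
    rw [norm_of_nonneg b.nonneg]
    exact b.le_one
  have hb0 : b 0 = 1 := b.one_of_mem_closedBall (by simp [b])
  have L1 := (tendsto_integral_dilation_mul hb.continuous hb1 h1).const_mul ((N : ℝ) / 2)
  have L2 := (tendsto_integral_dilation_mul hb.continuous hb1 h2).sub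
    ((tendsto_integral_dilation_mul hbd hC h1).const_mul (1 / 2))
  simp only [hb0, map_zero, one_mul, zero_mul, mul_zero, sub_zero] at L1 L2
  refine le_of_tendsto_of_tendsto' L1 L2 fun n => ?_
  have hn : (1 / ((n : ℝ) + 1)) ≠ 0 := by positivity
  have h := spectral_inequality_cutoff (φ := fun y => b ((1 / ((n : ℝ) + 1)) • y)) hf
    (hb.comp (contDiff_const_smul _)) (b.hasCompactSupport.comp_smul hn) fun _ => b.nonneg
  have hderiv (y : EuclideanSpace ℝ (Fin N)) :
      fderiv ℝ (fun z => b ((1 / ((n : ℝ) + 1)) • z)) y y =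
        fderiv ℝ b ((1 / ((n : ℝ) + 1)) • y) ((1 / ((n : ℝ) + 1)) • y) := by
    rw [fderiv_comp_smul]
    simp
  simpa only [hderiv] using h
end

section
/- Let N ≥ 3 be an integer, p > 1, 0 < λ < 1, ρ(y) = exp(|y|²/4), and let v : ℝ^N × (0,∞) → ℝ be a smooth nonnegative global solution of the rescaled equation ∂_s v = Δv + (y/2)·∇v + v/(p−1) + v^p such that: v(·,s) ∈ H¹_ρ ∩ L^{p+1}_ρ for every s > 0; lim_{s→∞} ∫_{ℝ^N} |∇v(y,s)|² ρ(y) dy = 0; and v satisfies the Wang bound 0 ≤ v(y,s) ≤ [(λ^{1−p}−1)(p−1)]^{−1/(p−1)}·[e^s/(e^s−1)]^{1/(p−1)} for all y ∈ ℝ^N, s > 0. Then lim_{s→∞} E(v(·,s)) = 0. -/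
open MeasureTheory Real
open scoped InnerProductSpace

/-- The operator `Lw = -Δw - (y/2)·∇w`. -/
noncomputable def Lop {N : ℕ} (w : EuclideanSpace ℝ (Fin N) → ℝ)
    (y : EuclideanSpace ℝ (Fin N)) : ℝ :=
  - lap w y - (1/2) * ⟪y, gradient w y⟫_ℝ

/-- The entropy functional `E(w) = ∫ [½|∇w|² - w²/(2(p-1)) - w^{p+1}/(p+1)] ρ dy`. -/
noncomputable def entropy {N : ℕ} (p : ℝ) (w : EuclideanSpace ℝ (Fin N) → ℝ) : ℝ :=
  ∫ y, ((1/2) * ‖gradient w y‖ ^ 2 - w y ^ 2 / (2 * (p - 1)) - w y ^ (p + 1) / (p + 1)) * rho y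

/-- `v` solves the rescaled equation `∂ₛv = Δv + (y/2)·∇v + v/(p-1) + vᵖ` for `s > 0`. -/
def IsRescaledSolution {N : ℕ} (p : ℝ) (v : ℝ → EuclideanSpace ℝ (Fin N) → ℝ) : Prop :=
  ∀ (y : EuclideanSpace ℝ (Fin N)) (s : ℝ), 0 < s →
    deriv (fun τ => v τ y) s =
      lap (v s) y + (1/2) * ⟪y, gradient (v s) y⟫_ℝ + v s y / (p - 1) + v s y ^ p

/-- The Wang bound `0 ≤ v(y,s) ≤ [(λ^{1-p}-1)(p-1)]^{-1/(p-1)}·[eˢ/(eˢ-1)]^{1/(p-1)}`. -/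
def WangBound {N : ℕ} (p lam : ℝ) (v : ℝ → EuclideanSpace ℝ (Fin N) → ℝ) : Prop :=
  ∀ (y : EuclideanSpace ℝ (Fin N)) (s : ℝ), 0 < s →
    0 ≤ v s y ∧ v s y ≤ ((lam ^ (1 - p) - 1) * (p - 1)) ^ (-(1 / (p - 1))) *
      (Real.exp s / (Real.exp s - 1)) ^ (1 / (p - 1))

section WeightedPoincare

variable {N : ℕ}

lemma rho_pos (y : EuclideanSpace ℝ (Fin N)) : 0 < rho y := Real.exp_pos _

lemma continuous_rho : Continuous (rho : EuclideanSpace ℝ (Fin N) → ℝ) := by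
  unfold rho
  fun_prop

lemma hasLineDerivAt_rho (x e : EuclideanSpace ℝ (Fin N)) :
    HasLineDerivAt ℝ rho (rho x * (⟪x, e⟫_ℝ / 2)) x e := by
  have h := (((hasFDerivAt_id x).norm_sq.mul_const (1 / 4 : ℝ)).exp).hasLineDerivAt e
  have hr : (rho : EuclideanSpace ℝ (Fin N) → ℝ) = fun y => Real.exp (‖id y‖ ^ 2 * (1 / 4)) := by
    funext y
    simp only [rho, id]
    congr 1
    ring
  have hd : rho x * (⟪x, e⟫_ℝ / 2) = (Real.exp (‖id x‖ ^ 2 * (1 / 4)) • (1 / 4 : ℝ) •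
      2 • (innerSL ℝ (id x)).comp (ContinuousLinearMap.id ℝ (EuclideanSpace ℝ (Fin N)))) e := by
    rw [hr]
    simp
    ring
  rw [hd, hr]
  exact h

/-- The derivative of `⟪x, e⟫ / (1 + ⟪x, e⟫²) ρ(x)` in the direction of the unit vector `e`. -/
lemma hasLineDerivAt_inner_div_mul_rho (x : EuclideanSpace ℝ (Fin N))
    {e : EuclideanSpace ℝ (Fin N)} (he : ‖e‖ = 1) :
    HasLineDerivAt ℝ (fun y => ⟪y, e⟫_ℝ / (1 + ⟪y, e⟫_ℝ ^ 2) * rho y)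
      ((2 - ⟪x, e⟫_ℝ ^ 2 + ⟪x, e⟫_ℝ ^ 4) / (2 * (1 + ⟪x, e⟫_ℝ ^ 2) ^ 2) * rho x) x e := by
  have ha : HasDerivAt (fun t : ℝ => ⟪x + t • e, e⟫_ℝ) 1 0 := by
    have h : (fun t : ℝ => ⟪x + t • e, e⟫_ℝ) = fun t => ⟪x, e⟫_ℝ + t := by
      funext t
      rw [inner_add_left, real_inner_smul_left, real_inner_self_eq_norm_sq, he]
      ring
    rw [h]
    exact (hasDerivAt_id (0 : ℝ)).const_add _
  have hd : (1 + ⟪x, e⟫_ℝ ^ 2) ≠ 0 := by positivity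
  have h := (ha.fun_div ((ha.fun_pow 2).const_add 1) (by simpa using hd)).mul
    (hasLineDerivAt_rho x e)
  simp only [zero_smul, add_zero] at h
  refine HasDerivAt.congr_deriv h ?_
  field_simp
  ring

lemma abs_fderiv_le_norm_gradient (w : EuclideanSpace ℝ (Fin N) → ℝ)
    (x : EuclideanSpace ℝ (Fin N)) {e : EuclideanSpace ℝ (Fin N)} (he : ‖e‖ = 1) :
    |fderiv ℝ w x e| ≤ ‖gradient w x‖ := by
  rw [← inner_gradient_left]
  simpa [he] using abs_real_inner_le_norm (gradient w x) e

/-- A Poincaré inequality for the weight `ρ = exp (|y|² / 4)`. -/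
lemma integral_sq_mul_rho_le (hN : 0 < N) {w : EuclideanSpace ℝ (Fin N) → ℝ}
    (hw : ContDiff ℝ 1 w) (h1 : Integrable (fun y => w y ^ 2 * rho y))
    (h2 : Integrable (fun y => ‖gradient w y‖ ^ 2 * rho y)) :
    ∫ y, w y ^ 2 * rho y ≤ 25 * ∫ y, ‖gradient w y‖ ^ 2 * rho y := by
  set e : EuclideanSpace ℝ (Fin N) := EuclideanSpace.single ⟨0, hN⟩ 1 with he_def
  have he : ‖e‖ = 1 := by simp [he_def]
  have hwc : Continuous w := hw.continuous
  have hdc : Continuous fun y => fderiv ℝ w y e :=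
    (hw.continuous_fderiv one_ne_zero).clm_apply continuous_const
  have hrc := continuous_rho (N := N)
  have hpos : ∀ y : EuclideanSpace ℝ (Fin N), 0 < 1 + ⟪y, e⟫_ℝ ^ 2 := fun y => by positivity
  have hg : ∀ y : EuclideanSpace ℝ (Fin N), |⟪y, e⟫_ℝ / (1 + ⟪y, e⟫_ℝ ^ 2)| ≤ 1 / 2 := by
    intro y
    rw [abs_div, abs_of_pos (hpos y), div_le_iff₀ (hpos y), ← sq_abs ⟪y, e⟫_ℝ]
    nlinarith [sq_nonneg (|⟪y, e⟫_ℝ| - 1)]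
  set k : EuclideanSpace ℝ (Fin N) → ℝ := fun y =>
    (2 - ⟪y, e⟫_ℝ ^ 2 + ⟪y, e⟫_ℝ ^ 4) / (2 * (1 + ⟪y, e⟫_ℝ ^ 2) ^ 2) with hk
  have hk_lower : ∀ y, 1 / 5 ≤ k y := by
    intro y
    simp only [hk]
    rw [le_div_iff₀ (by have := hpos y; positivity)]
    nlinarith [sq_nonneg (⟪y, e⟫_ℝ ^ 2 - 3 / 2)]
  have hk_upper : ∀ y, k y ≤ 1 := by
    intro y
    simp only [hk]
    rw [div_le_one (by have := hpos y; positivity)]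
    nlinarith [sq_nonneg (⟪y, e⟫_ℝ), sq_nonneg (⟪y, e⟫_ℝ ^ 2)]
  have hkc : Continuous k := by
    simp only [hk]
    exact Continuous.div (by fun_prop) (by fun_prop) fun y => by have := hpos y; positivity
  have hgc : Continuous fun y : EuclideanSpace ℝ (Fin N) => ⟪y, e⟫_ℝ / (1 + ⟪y, e⟫_ℝ ^ 2) :=
    Continuous.div (by fun_prop) (by fun_prop) fun y => (hpos y).ne'
  have hfg' : Integrable fun y => w y ^ 2 * (k y * rho y) := by
    refine h1.mono' (by fun_prop) (.of_forall fun y => ?_)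
    have := hk_lower y
    have hr := rho_pos y
    rw [Real.norm_of_nonneg (by positivity)]
    have := mul_le_mul_of_nonneg_right (hk_upper y) (show 0 ≤ w y ^ 2 * rho y by positivity)
    linarith
  have hfg : Integrable fun y => w y ^ 2 * (⟪y, e⟫_ℝ / (1 + ⟪y, e⟫_ℝ ^ 2) * rho y) := by
    refine h1.mono' (by fun_prop) (.of_forall fun y => ?_)
    have hr := rho_pos y
    rw [Real.norm_eq_abs, abs_mul, abs_mul, abs_of_pos hr, abs_of_nonneg (sq_nonneg (w y))]
    have := mul_le_mul_of_nonneg_right (hg y) (show 0 ≤ w y ^ 2 * rho y by positivity)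
    nlinarith [show 0 ≤ w y ^ 2 * rho y by positivity]
  have hbound : ∀ y, |2 * w y * fderiv ℝ w y e *
      (⟪y, e⟫_ℝ / (1 + ⟪y, e⟫_ℝ ^ 2) * rho y)| ≤
      1 / 10 * (w y ^ 2 * rho y) + 5 / 2 * (‖gradient w y‖ ^ 2 * rho y) := by
    intro y
    have hr := rho_pos y
    have hd := abs_fderiv_le_norm_gradient w y he
    have h3 : |w y| * |fderiv ℝ w y e| ≤ 1 / 10 * w y ^ 2 + 5 / 2 * ‖gradient w y‖ ^ 2 := by
      have := mul_le_mul_of_nonneg_left hd (abs_nonneg (w y))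
      rw [← sq_abs (w y)]
      nlinarith [sq_nonneg (|w y| - 5 * ‖gradient w y‖)]
    have h4 : |w y| * |fderiv ℝ w y e| * |⟪y, e⟫_ℝ / (1 + ⟪y, e⟫_ℝ ^ 2)| ≤
        |w y| * |fderiv ℝ w y e| * (1 / 2) := mul_le_mul_of_nonneg_left (hg y) (by positivity)
    rw [abs_mul, abs_mul, abs_mul, abs_mul, abs_of_pos hr, abs_two]
    nlinarith [mul_le_mul_of_nonneg_right (h4.trans
      (mul_le_mul_of_nonneg_right h3 (by norm_num))) hr.le]
  have hint := (h1.const_mul (1 / 10)).add (h2.const_mul (5 / 2))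
  have hf'g : Integrable fun y => 2 * w y * fderiv ℝ w y e *
      (⟪y, e⟫_ℝ / (1 + ⟪y, e⟫_ℝ ^ 2) * rho y) :=
    hint.mono' (by fun_prop) (.of_forall hbound)
  have hparts := integral_bilinear_hasLineDerivAt_right_eq_neg_left_of_integrable
    (μ := (volume : Measure (EuclideanSpace ℝ (Fin N))))
    (f := fun y => w y ^ 2) (f' := fun y => 2 * w y * fderiv ℝ w y e)
    (g := fun y => ⟪y, e⟫_ℝ / (1 + ⟪y, e⟫_ℝ ^ 2) * rho y) (g' := fun y => k y * rho y) (v := e)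
    (B := ContinuousLinearMap.mul ℝ ℝ) hf'g hfg' hfg
    (fun x _ => by
      convert ((hw.differentiable one_ne_zero x).hasFDerivAt.pow 2).hasLineDerivAt e using 1
      simp)
    (fun x _ => hasLineDerivAt_inner_div_mul_rho x he)
  simp only [ContinuousLinearMap.mul_apply'] at hparts
  have hlow : 1 / 5 * ∫ y, w y ^ 2 * rho y ≤ ∫ y, w y ^ 2 * (k y * rho y) := by
    rw [← integral_const_mul]
    refine integral_mono (h1.const_mul _) hfg' fun y => ?_
    have hr := rho_pos y
    have := mul_le_mul_of_nonneg_right (hk_lower y) (show 0 ≤ w y ^ 2 * rho y by positivity)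
    simp only
    linarith
  have hupp : -∫ y, 2 * w y * fderiv ℝ w y e * (⟪y, e⟫_ℝ / (1 + ⟪y, e⟫_ℝ ^ 2) * rho y) ≤
      1 / 10 * (∫ y, w y ^ 2 * rho y) + 5 / 2 * ∫ y, ‖gradient w y‖ ^ 2 * rho y := by
    rw [← integral_const_mul, ← integral_const_mul,
      ← integral_add (h1.const_mul _) (h2.const_mul _), ← integral_neg]
    exact integral_mono hf'g.neg hint fun y => (neg_le_abs _).trans (hbound y)
  linarith

end WeightedPoincare

/-- The entropy is controlled by its three terms, the last one by the second for bounded `w`. -/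
lemma abs_entropy_le {N : ℕ} {p K : ℝ} (hp : 1 < p) {w : EuclideanSpace ℝ (Fin N) → ℝ}
    (hnonneg : ∀ y, 0 ≤ w y) (hK : ∀ y, w y ^ (p - 1) ≤ K)
    (h1 : Integrable (fun y => w y ^ 2 * rho y))
    (h2 : Integrable (fun y => ‖gradient w y‖ ^ 2 * rho y)) :
    |entropy p w| ≤ 1 / 2 * (∫ y, ‖gradient w y‖ ^ 2 * rho y) +
      (1 / (2 * (p - 1)) + K / (p + 1)) * ∫ y, w y ^ 2 * rho y := by
  rw [← integral_const_mul, ← integral_const_mul,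
    ← integral_add (h2.const_mul _) (h1.const_mul _), ← Real.norm_eq_abs]
  refine norm_integral_le_of_norm_le ((h2.const_mul _).add (h1.const_mul _))
    (.of_forall fun y => ?_)
  have hr := rho_pos y
  have hp1 : 0 < p - 1 := by linarith
  have hp2 : 0 < p + 1 := by linarith
  have hpow : w y ^ (p + 1) ≤ K * w y ^ 2 := by
    have : w y ^ (p + 1) = w y ^ (p - 1) * w y ^ 2 := by
      rw [← Real.rpow_natCast (w y) 2, ← Real.rpow_add_of_nonneg (hnonneg y) hp1.le (by norm_num)]
      congr 1
      push_cast
      ring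
    rw [this]
    exact mul_le_mul_of_nonneg_right (hK y) (sq_nonneg _)
  have hpow0 : 0 ≤ w y ^ (p + 1) / (p + 1) := div_nonneg (Real.rpow_nonneg (hnonneg y) _) hp2.le
  have hpow1 := div_le_div_of_nonneg_right hpow hp2.le
  have hsq : 0 ≤ w y ^ 2 / (2 * (p - 1)) := by positivity
  have hgr : 0 ≤ 1 / 2 * ‖gradient w y‖ ^ 2 := by positivity
  rw [Real.norm_eq_abs, abs_mul, abs_of_pos hr]
  calc _ ≤ (1 / 2 * ‖gradient w y‖ ^ 2 + w y ^ 2 / (2 * (p - 1)) + K * w y ^ 2 / (p + 1)) *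
        rho y := by
        refine mul_le_mul_of_nonneg_right (abs_le.2 ⟨?_, ?_⟩) hr.le <;> linarith
    _ = _ := by ring

lemma WangBound.rpow_le {N : ℕ} {p lam : ℝ} (hp : 1 < p) (hlam0 : 0 < lam) (hlam1 : lam < 1)
    {v : ℝ → EuclideanSpace ℝ (Fin N) → ℝ} (hv : WangBound p lam v) {s : ℝ} (hs : 1 ≤ s)
    (y : EuclideanSpace ℝ (Fin N)) :
    v s y ^ (p - 1) ≤ (((lam ^ (1 - p) - 1) * (p - 1)) ^ (-(1 / (p - 1))) *
      2 ^ (1 / (p - 1))) ^ (p - 1) := by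
  have hp1 : 0 < p - 1 := by linarith
  obtain ⟨h0, h⟩ := hv y s (by linarith)
  refine Real.rpow_le_rpow h0 (h.trans ?_) hp1.le
  have hlam : 1 ≤ lam ^ (1 - p) :=
    Real.one_le_rpow_of_pos_of_le_one_of_nonpos hlam0 hlam1.le (by linarith)
  have hexp : 2 ≤ Real.exp s := by linarith [Real.add_one_le_exp s]
  refine mul_le_mul_of_nonneg_left (Real.rpow_le_rpow ?_ ?_ (by positivity))
    (Real.rpow_nonneg (mul_nonneg (by linarith) hp1.le) _)
  · exact div_nonneg (by linarith) (by linarith)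
  · rw [div_le_iff₀ (by linarith)]
    linarith

/-- for a smooth nonnegative global solution of the rescaled equation in
`H¹_ρ ∩ L^{p+1}_ρ`, with `∫|∇v|²ρ → 0` and satisfying the Wang bound, the entropy tends
to zero: `lim_{s→∞} E(v(·,s)) = 0`. -/
theorem stmt4 (N : ℕ) (hN : 3 ≤ N) (p lam : ℝ) (hp : 1 < p)
    (hlam0 : 0 < lam) (hlam1 : lam < 1)
    (v : ℝ → EuclideanSpace ℝ (Fin N) → ℝ)
    (hsmooth : ContDiff ℝ (⊤ : ℕ∞) (fun q : ℝ × EuclideanSpace ℝ (Fin N) => v q.1 q.2))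
    (hnonneg : ∀ (s : ℝ) (y : EuclideanSpace ℝ (Fin N)), 0 < s → 0 ≤ v s y)
    (hsol : IsRescaledSolution p v)
    (hint1 : ∀ s : ℝ, 0 < s → Integrable (fun y => v s y ^ 2 * rho y))
    (hint2 : ∀ s : ℝ, 0 < s → Integrable (fun y => ‖gradient (v s) y‖ ^ 2 * rho y))
    (hint3 : ∀ s : ℝ, 0 < s → Integrable (fun y => v s y ^ (p + 1) * rho y))
    (hgrad : Filter.Tendsto (fun s => ∫ y, ‖gradient (v s) y‖ ^ 2 * rho y)
      Filter.atTop (nhds 0))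
    (hwang : WangBound p lam v) :
    Filter.Tendsto (fun s => entropy p (v s)) Filter.atTop (nhds 0) := by
  set K := (((lam ^ (1 - p) - 1) * (p - 1)) ^ (-(1 / (p - 1))) *
    2 ^ (1 / (p - 1))) ^ (p - 1)
  have hp1 : 0 < p - 1 := by linarith
  have hK0 : 0 ≤ K :=
    (Real.rpow_nonneg (hnonneg 1 0 one_pos) _).trans (hwang.rpow_le hp hlam0 hlam1 le_rfl 0)
  have hlim := hgrad.const_mul (1 / 2 + (1 / (2 * (p - 1)) + K / (p + 1)) * 25)
  rw [mul_zero] at hlim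
  refine squeeze_zero_norm' ?_ hlim
  filter_upwards [Filter.eventually_ge_atTop 1] with s hs
  have hs0 : 0 < s := by linarith
  have hvs : ContDiff ℝ 1 (v s) :=
    (hsmooth.comp (contDiff_const.prodMk contDiff_id) :
      ContDiff ℝ (⊤ : ℕ∞) fun y => v s y).of_le (by exact_mod_cast le_top)
  have hE := abs_entropy_le hp (fun y => hnonneg s y hs0)
    (fun y => hwang.rpow_le hp hlam0 hlam1 hs y) (hint1 s hs0) (hint2 s hs0)
  have hP := integral_sq_mul_rho_le (by lia) hvs (hint1 s hs0) (hint2 s hs0)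
  have hc : 0 ≤ 1 / (2 * (p - 1)) + K / (p + 1) := by
    have : 0 < p + 1 := by linarith
    positivity
  have := mul_le_mul_of_nonneg_left hP hc
  rw [Real.norm_eq_abs]
  linarith
end

section
/- Let γ, a, B > 0 and s₁ ≥ 0 be real numbers. Let E, I : (0,∞) → ℝ be differentiable with E′(s) = −I(s) and I(s) ≥ 0 for all s > 0, lim_{s→∞} E(s) = 0, and suppose there is a measurable K : (0,∞) → ℝ with 0 ≤ K(s) ≤ B·e^{−(2γ+a)s} for all s ≥ s₁ and E′(s) ≥ (1/(2γ))·I′(s) − (1/(2γ))·K(s) for all s ≥ s₁. Then for every s ≥ s₁, E(s) ≤ (1/(2γ))·I(s) + (B/(2γ(2γ+a)))·e^{−(2γ+a)s}. -/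
open MeasureTheory

/-- comparison argument. If `E' = -I` with `I ≥ 0`, `E(s) → 0` as `s → ∞`,
`0 ≤ K(s) ≤ B·e^{-(2γ+a)s}` for `s ≥ s₁`, and `E'(s) ≥ (1/(2γ))I'(s) - (1/(2γ))K(s)` for
`s ≥ s₁`, then `E(s) ≤ (1/(2γ))I(s) + (B/(2γ(2γ+a)))e^{-(2γ+a)s}` for every `s ≥ s₁`. -/
theorem stmt15 (γ a B s₁ : ℝ) (hγ : 0 < γ) (ha : 0 < a) (hB : 0 < B) (hs₁ : 0 ≤ s₁)
    (E I I' K : ℝ → ℝ)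
    (hE : ∀ s : ℝ, 0 < s → HasDerivAt E (-(I s)) s)
    (hI : ∀ s : ℝ, 0 < s → HasDerivAt I (I' s) s)
    (hI0 : ∀ s : ℝ, 0 < s → 0 ≤ I s)
    (hElim : Filter.Tendsto E Filter.atTop (nhds 0))
    (hKmeas : Measurable K)
    (hK : ∀ s : ℝ, s₁ ≤ s → 0 ≤ K s ∧ K s ≤ B * Real.exp (-(2 * γ + a) * s))
    (hcmp : ∀ s : ℝ, s₁ ≤ s →
      (1 / (2 * γ)) * I' s - (1 / (2 * γ)) * K s ≤ -(I s)) :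
    ∀ s : ℝ, s₁ ≤ s → 0 < s →
      E s ≤ (1 / (2 * γ)) * I s
        + (B / (2 * γ * (2 * γ + a))) * Real.exp (-(2 * γ + a) * s) := by
  intro s hs hs0
  set c := 2 * γ + a
  have hc0 : 0 < c := by positivity
  let G : ℝ → ℝ := fun t =>
    E t - (1 / (2 * γ)) * I t - (B / (2 * γ * c)) * Real.exp (-c * t)
  have hG : ∀ t : ℝ, 0 < t → HasDerivAt G
      (-(I t) - (1 / (2 * γ)) * I' t
        - (B / (2 * γ * c)) * (Real.exp (-c * t) * (-c * 1))) t := fun t ht =>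
    ((hE t ht).sub ((hI t ht).const_mul _)).sub
      ((((hasDerivAt_id t).const_mul (-c)).exp).const_mul _)
  have hmono : MonotoneOn G (Set.Ici s) := by
    refine monotoneOn_of_hasDerivWithinAt_nonneg (convex_Ici s)
      (fun t ht => (hG t (hs0.trans_le ht)).continuousAt.continuousWithinAt)
      (fun t ht => (hG t (hs0.trans_le (interior_subset ht))).hasDerivWithinAt)
      fun t ht => ?_
    have hst : s₁ ≤ t := hs.trans (interior_subset ht)
    have hKt := mul_le_mul_of_nonneg_left (hK t hst).2
      (by positivity : 0 ≤ 1 / (2 * γ))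
    have hexp : (B / (2 * γ * c)) * (Real.exp (-c * t) * (-c * 1))
        = -((1 / (2 * γ)) * (B * Real.exp (-c * t))) := by
      field_simp
    rw [hexp]
    linarith [hcmp t hst]
  have hle : G s ≤ 0 := by
    refine ge_of_tendsto hElim ?_
    filter_upwards [Filter.eventually_ge_atTop s] with t ht
    have hGt : G s ≤ G t := hmono Set.self_mem_Ici ht ht
    have hIt : 0 ≤ (1 / (2 * γ)) * I t :=
      mul_nonneg (by positivity) (hI0 t (hs0.trans_le ht))
    have hexp : 0 ≤ (B / (2 * γ * c)) * Real.exp (-c * t) := by positivity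
    simp only [G] at hGt ⊢
    linarith
  simp only [G] at hle
  linarith
end
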